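/- Assume c(x,y) = k(y−x) with k satisfying (H1) and (H3). Then the function e(m) := ℰ(m)/m is (strictly) increasing on (0,∞). As a consequence, ℰ is strictly superadditive: for all 0 < m' < m, ℰ(m') + ℰ(m − m') < ℰ(m). -/

import Mathlib

open MeasureTheory ENNReal Filter Set

noncomputable section

/-- Euclidean space `ℝ^d`. -/
abbrev Rd (d : ℕ) : Type := EuclideanSpace ℝ (Fin d)

/-- The measure `f · Leb` on `ℝ^d`. -/
def fMeas {d : ℕ} (f : Rd d → ℝ) : Measure (Rd d) :=
  MeasureTheory.volume.withDensity fun x => ENNReal.ofReal (f x)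

/-- The set `Π_f` of admissible exterior transport plans: first marginal `f · Leb`,
second marginal `≤ (1 - f) · Leb`. -/
def ExtPlans {d : ℕ} (f : Rd d → ℝ) : Set (Measure (Rd d × Rd d)) :=
  {γ | γ.map Prod.fst = fMeas f ∧ γ.map Prod.snd ≤ fMeas fun x => 1 - f x}

/-- The transport cost `∫ c dγ` of a plan `γ`. -/
def planCost {d : ℕ} (c : Rd d → Rd d → ℝ) (γ : Measure (Rd d × Rd d)) : ℝ≥0∞ :=
  ∫⁻ p, ENNReal.ofReal (c p.1 p.2) ∂γ

/-- The functional `Υ(f) = inf { ∫ c dγ : γ ∈ Π_f }`. -/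
def Ups {d : ℕ} (c : Rd d → Rd d → ℝ) (f : Rd d → ℝ) : ℝ≥0∞ :=
  ⨅ γ ∈ ExtPlans f, planCost c γ

/-- `f ∈ L¹(ℝ^d, [0,1])`. -/
def InUnit {d : ℕ} (f : Rd d → ℝ) : Prop :=
  Integrable f MeasureTheory.volume ∧ ∀ x, 0 ≤ f x ∧ f x ≤ 1

/-- `f ∈ L¹_m`: in `L¹(ℝ^d,[0,1])` with `∫ f ≤ m`. -/
def MemL1m {d : ℕ} (m : ℝ) (f : Rd d → ℝ) : Prop := InUnit f ∧ (∫ x, f x) ≤ m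

/-- The energy `ℰ(m) = sup { Υ(f) : f ∈ L¹(ℝ^d,[0,1]), ∫ f = m }`. -/
def Energy {d : ℕ} (c : Rd d → Rd d → ℝ) (m : ℝ) : ℝ≥0∞ :=
  ⨆ f ∈ {f : Rd d → ℝ | InUnit f ∧ (∫ x, f x) = m}, Ups c f

/-- Hypothesis (H1): `k` continuous, `k 0 = 0`, `k → ∞` at infinity. -/
def H1 {d : ℕ} (k : Rd d → ℝ) : Prop :=
  Continuous k ∧ k 0 = 0 ∧ Tendsto k (Bornology.cobounded (Rd d)) atTop

/-- Hypothesis (H2). -/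
def H2 {d : ℕ} (k : Rd d → ℝ) : Prop :=
  ∀ x : Rd d, x ≠ 0 →
    0 < Filter.limsup
      (fun r : ℝ =>
        MeasureTheory.volume (Metric.ball x r ∩ {y | k y < k x}) / ENNReal.ofReal (r ^ d))
      (nhdsWithin 0 (Set.Ioi 0))

/-- Hypothesis (H3): `r ↦ k (r σ)` increasing on `[0, ∞)` for every unit direction `σ`. -/
def H3 {d : ℕ} (k : Rd d → ℝ) : Prop :=
  ∀ σ : Rd d, ‖σ‖ = 1 → StrictMonoOn (fun r : ℝ => k (r • σ)) (Set.Ici 0)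

/-- Translation-invariant cost `c(x,y) = k(y - x)`. -/
def transCost {d : ℕ} (k : Rd d → ℝ) : Rd d → Rd d → ℝ := fun x y => k (y - x)

/-- The support of a measure: points all of whose open neighbourhoods have positive measure. -/
def msupport {α : Type*} [TopologicalSpace α] [MeasurableSpace α] (μ : Measure α) : Set α :=
  {x | ∀ U : Set α, IsOpen U → x ∈ U → 0 < μ U}

/-- Under (H3), dilations strictly increase `k` away from the origin. -/
lemma H3.lt_smul {d : ℕ} {k : Rd d → ℝ} (h3 : H3 k) {z : Rd d} (hz : z ≠ 0) {l : ℝ}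
    (hl : 1 < l) : k z < k (l • z) := by
  have hn : 0 < ‖z‖ := norm_pos_iff.2 hz
  have hσ : ‖(‖z‖⁻¹ • z : Rd d)‖ = 1 := by
    rw [norm_smul, norm_inv, norm_norm, inv_mul_cancel₀ hn.ne']
  have h := h3 _ hσ (a := ‖z‖) hn.le (b := l * ‖z‖) (mem_Ici.2 (by positivity))
    (by nlinarith)
  simpa [smul_smul, mul_assoc, mul_inv_cancel₀ hn.ne'] using h

lemma H3.le_smul {d : ℕ} {k : Rd d → ℝ} (h3 : H3 k) (z : Rd d) {l : ℝ}
    (hl : 1 ≤ l) : k z ≤ k (l • z) := by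
  rcases eq_or_ne z 0 with rfl | hz
  · simp
  rcases hl.eq_or_lt with rfl | hl
  · simp
  · exact (h3.lt_smul hz hl).le

lemma H3.pos {d : ℕ} {k : Rd d → ℝ} (h1 : H1 k) (h3 : H3 k) {z : Rd d} (hz : z ≠ 0) :
    0 < k z := by
  have hn : 0 < ‖z‖ := norm_pos_iff.2 hz
  have hσ : ‖(‖z‖⁻¹ • z : Rd d)‖ = 1 := by
    rw [norm_smul, norm_inv, norm_norm, inv_mul_cancel₀ hn.ne']
  have h := h3 _ hσ (a := 0) (mem_Ici.2 le_rfl) (b := ‖z‖) hn.le hn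
  simpa [smul_smul, mul_inv_cancel₀ hn.ne', h1.2.1] using h

/-- Away from the origin, `k` is bounded below by a positive constant. -/
lemma exists_pos_le_of_le_norm {d : ℕ} {k : Rd d → ℝ} (h1 : H1 k) (h3 : H3 k) {r : ℝ}
    (hr : 0 < r) : ∃ κ > 0, ∀ z : Rd d, r ≤ ‖z‖ → κ ≤ k z := by
  obtain ⟨κ, hκ, h⟩ := (isCompact_sphere (0 : Rd d) r).exists_forall_le' h1.1.continuousOn
    (a := 0) (fun z hz => h3.pos h1 (by rintro rfl; simp at hz; exact hr.ne hz))
  refine ⟨κ, hκ, fun z hz => ?_⟩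
  have hn : 0 < ‖z‖ := hr.trans_le hz
  refine (h ((r / ‖z‖) • z) ?_).trans ?_
  · simp [norm_smul, abs_of_pos hr, hn.ne']
  · have := h3.le_smul ((r / ‖z‖) • z) (l := ‖z‖ / r) ((one_le_div hr).2 hz)
    rwa [smul_smul, div_mul_div_comm, mul_comm, div_self (by positivity), one_smul] at this

/-- Quantitative gain under dilation on the sublevel sets of `k`. -/
lemma exists_gain {d : ℕ} {k : Rd d → ℝ} (h1 : H1 k) (h3 : H3 k) {l ε : ℝ}
    (hl : 1 < l) (hε : 0 < ε) (T : ℝ) :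
    ∃ c > 0, c ≤ 1 ∧ ∀ z, k z ≤ T → (1 + c) * k z ≤ k (l • z) + c * ε := by
  have hS : IsCompact {z : Rd d | ε ≤ k z ∧ k z ≤ T} := by
    refine Metric.isCompact_of_isClosed_isBounded ?_ ?_
    · exact (isClosed_le continuous_const h1.1).inter (isClosed_le h1.1 continuous_const)
    · have h := h1.2.2.eventually_gt_atTop T
      refine (Bornology.isBounded_def.2 ?_ : Bornology.IsBounded {z : Rd d | k z ≤ T}).subset
        (fun z hz => hz.2)
      filter_upwards [h] with z hz
      simpa using hz
  have hk := h1.1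
  obtain ⟨a, ha, h⟩ := hS.exists_forall_le' (f := fun z => k (l • z) - k z) (a := 0)
    (by fun_prop) (fun z hz => sub_pos.2 (h3.lt_smul (by
      rintro rfl
      exact hε.not_ge (h1.2.1 ▸ hz.1)) hl))
  have hT : 0 < max T 1 := by positivity
  refine ⟨min 1 (a / max T 1), by positivity, min_le_left _ _, fun z hz => ?_⟩
  set c := min 1 (a / max T 1)
  have hc0 : 0 < c := by positivity
  by_cases hz' : ε ≤ k z
  · have h2 := h z ⟨hz', hz⟩
    have h3 : c * k z ≤ a := calc
      c * k z ≤ (a / max T 1) * max T 1 := by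
        gcongr
        · exact hε.le.trans hz'
        · exact min_le_right _ _
        · exact hz.trans (le_max_left _ _)
      _ = a := by field_simp
    have : 0 < c * ε := by positivity
    linarith
  · have h2 := h3.le_smul z hl.le
    have : c * k z ≤ c * ε := by gcongr; linarith
    linarith

/-- Euclidean space splits into countably many cells of uniformly bounded diameter and
of volume at least `V`. -/
lemma exists_cells {d : ℕ} (hd : 1 ≤ d) (V : ℝ) :
    ∃ (q : Rd d → Fin d → ℤ) (D : ℝ), Measurable q ∧ (∀ x y, q x = q y → ‖y - x‖ ≤ D) ∧
      ∀ i, ENNReal.ofReal V ≤ volume (q ⁻¹' {i}) ∧ volume (q ⁻¹' {i}) ≠ ∞ := by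
  set L := max 1 V
  have hL0 : 0 < L := by positivity
  have hvol : ∀ i : Fin d → ℤ,
      volume ((fun (x : Rd d) j => ⌊x j / L⌋) ⁻¹' {i}) = ENNReal.ofReal L ^ d := by
    intro i
    have : ((fun (x : Rd d) j => ⌊x j / L⌋) ⁻¹' {i}) =
        WithLp.ofLp ⁻¹' (Set.pi univ fun j => Ico ((i j : ℝ) * L) ((i j + 1) * L)) := by
      ext x
      simp only [mem_preimage, mem_singleton_iff, funext_iff, Set.mem_pi, mem_univ, true_imp_iff,
        Int.floor_eq_iff, mem_Ico, le_div_iff₀ hL0, div_lt_iff₀ hL0]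
    rw [this, (PiLp.volume_preserving_ofLp (Fin d)).measure_preimage
      (MeasurableSet.univ_pi fun _ => measurableSet_Ico).nullMeasurableSet, Real.volume_pi_Ico]
    simp [add_mul]
  refine ⟨fun x j => ⌊x j / L⌋, √(∑ _j : Fin d, L ^ 2), ?_, fun x y h => ?_, fun i => ?_⟩
  · exact measurable_pi_lambda _ fun j => Int.measurable_floor.comp (by fun_prop)
  · rw [EuclideanSpace.norm_eq]
    refine Real.sqrt_le_sqrt (Finset.sum_le_sum fun j _ => ?_)
    have hj := Int.abs_sub_lt_one_of_floor_eq_floor (congrFun h j)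
    rw [← sub_div, abs_div, abs_of_pos hL0, div_lt_one hL0, abs_sub_comm] at hj
    rw [Real.norm_eq_abs]
    gcongr
    exact hj.le
  · rw [hvol]
    refine ⟨(ENNReal.ofReal_le_ofReal (le_max_right 1 V)).trans ?_, by finiteness⟩
    exact le_self_pow (by simp) (by omega)

/-- Transport inside the cells of a partition: if each cell has more room than mass, there is a
plan moving mass only within cells. -/
lemma exists_plan_in_cells {α ι : Type*} [MeasurableSpace α] [MeasurableSpace ι] [Countable ι]
    [MeasurableSingletonClass ι] {q : α → ι} (hq : Measurable q) (μ ν : Measure α)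
    (hμν : ∀ i, μ (q ⁻¹' {i}) ≤ ν (q ⁻¹' {i})) (hν : ∀ i, ν (q ⁻¹' {i}) ≠ ∞) :
    ∃ γ : Measure (α × α), γ.map Prod.fst = μ ∧ γ.map Prod.snd ≤ ν ∧
      ∀ᵐ p ∂γ, q p.1 = q p.2 := by
  have hm : ∀ i, MeasurableSet (q ⁻¹' {i}) := fun i => hq (measurableSet_singleton i)
  have hsum : ∀ ρ : Measure α, Measure.sum (fun i => ρ.restrict (q ⁻¹' {i})) = ρ := by
    intro ρ
    rw [← Measure.restrict_iUnion _ hm, ← preimage_iUnion, iUnion_of_singleton, preimage_univ,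
      Measure.restrict_univ]
    intro i j hij
    exact Disjoint.preimage q (by simpa using hij)
  have hfin : ∀ i, IsFiniteMeasure (ν.restrict (q ⁻¹' {i})) :=
    fun i => isFiniteMeasure_restrict.2 (hν i)
  have hfin' : ∀ i, IsFiniteMeasure (μ.restrict (q ⁻¹' {i})) :=
    fun i => isFiniteMeasure_restrict.2 (ne_top_of_le_ne_top (hν i) (hμν i))
  have : SFinite μ := by
    rw [← hsum μ]
    infer_instance
  have : SFinite ν := by
    rw [← hsum ν]
    infer_instance
  refine ⟨Measure.sum fun i => (ν (q ⁻¹' {i}))⁻¹ •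
    (μ.restrict (q ⁻¹' {i})).prod (ν.restrict (q ⁻¹' {i})), ?_, ?_, ?_⟩
  · rw [Measure.map_sum measurable_fst.aemeasurable]
    conv_rhs => rw [← hsum μ]
    congr 1
    ext1 i
    rw [Measure.map_smul, Measure.map_fst_prod, Measure.restrict_apply_univ, smul_smul]
    rcases eq_or_ne (ν (q ⁻¹' {i})) 0 with h0 | h0
    · have : μ (q ⁻¹' {i}) = 0 := le_antisymm (h0 ▸ hμν i) zero_le
      rw [Measure.restrict_eq_zero.2 this, smul_zero]
    · rw [ENNReal.inv_mul_cancel h0 (hν i), one_smul]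
  · rw [Measure.map_sum measurable_snd.aemeasurable]
    conv_rhs => rw [← hsum ν]
    refine Measure.le_iff.2 fun s hs => ?_
    rw [Measure.sum_apply _ hs, Measure.sum_apply _ hs]
    refine ENNReal.tsum_le_tsum fun i => ?_
    rw [Measure.map_smul, Measure.map_snd_prod, Measure.restrict_apply_univ, smul_smul]
    have : (ν (q ⁻¹' {i}))⁻¹ * μ (q ⁻¹' {i}) ≤ 1 := by
      rw [mul_comm, ← div_eq_mul_inv]
      exact ENNReal.div_le_of_le_mul (by simpa using hμν i)
    rw [Measure.smul_apply, smul_eq_mul]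
    exact mul_le_of_le_one_left zero_le this
  · refine Measure.ae_sum_iff.2 fun i => Measure.ae_smul_measure ?_ _
    rw [Measure.prod_restrict]
    filter_upwards [ae_restrict_mem ((hm i).prod (hm i))] with p hp
    rw [mem_singleton_iff.1 hp.1, mem_singleton_iff.1 hp.2]

lemma fMeas_univ {d : ℕ} {f : Rd d → ℝ} (hf : InUnit f) :
    fMeas f univ = ENNReal.ofReal (∫ x, f x) := by
  rw [fMeas, withDensity_apply _ MeasurableSet.univ, Measure.restrict_univ,
    ofReal_integral_eq_lintegral_ofReal hf.1 (ae_of_all _ fun x => (hf.2 x).1)]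

lemma fMeas_one_sub_add {d : ℕ} {f : Rd d → ℝ} (hf : InUnit f) :
    (fMeas fun x => 1 - f x) + fMeas f = volume := by
  have hm : AEMeasurable (fun x => ENNReal.ofReal (f x)) (volume : Measure (Rd d)) :=
    hf.1.aemeasurable.ennreal_ofReal
  ext s hs
  rw [Measure.add_apply, fMeas, fMeas, withDensity_apply _ hs, withDensity_apply _ hs,
    ← lintegral_add_right' _ hm.restrict, ← setLIntegral_one]
  refine lintegral_congr fun x => ?_
  rw [← ENNReal.ofReal_add (by linarith [(hf.2 x).2]) (hf.2 x).1]
  simp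

lemma ExtPlans.measure_univ {d : ℕ} {f : Rd d → ℝ} (hf : InUnit f)
    {γ : Measure (Rd d × Rd d)} (hγ : γ ∈ ExtPlans f) :
    γ univ = ENNReal.ofReal (∫ x, f x) := by
  rw [← fMeas_univ hf, ← hγ.1, Measure.map_apply measurable_fst MeasurableSet.univ,
    preimage_univ]

/-- The part `μ` of the mass left over by a partial plan `γ` can be transported at a unit cost
bounded by a constant which depends only on the total mass. -/
lemma exists_Ups_le {d : ℕ} (hd : 1 ≤ d) {k : Rd d → ℝ} (hk : Continuous k) {m : ℝ}
    (hm : 0 < m) :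
    ∃ K > 0, ∀ f : Rd d → ℝ, InUnit f → ∫ x, f x = m →
      ∀ (γ : Measure (Rd d × Rd d)) (μ : Measure (Rd d)), γ.map Prod.fst + μ = fMeas f →
        γ.map Prod.snd ≤ (fMeas fun x => 1 - f x) →
        Ups (transCost k) f ≤ planCost (transCost k) γ + ENNReal.ofReal K * μ univ := by
  obtain ⟨q, D, hq, hD, hV⟩ := exists_cells hd (m + m + m)
  obtain ⟨K, hK⟩ := (isCompact_closedBall (0 : Rd d) D).bddAbove_image hk.continuousOn
  refine ⟨max K 1, by positivity, fun f hf hfm γ μ hγμ hγ => ?_⟩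
  have hu : γ univ + μ univ = ENNReal.ofReal m := by
    rw [← hfm, ← fMeas_univ hf, ← hγμ, Measure.add_apply,
      Measure.map_apply measurable_fst MeasurableSet.univ, preimage_univ]
  have hγu : (γ.map Prod.snd) univ ≤ ENNReal.ofReal m := by
    rw [Measure.map_apply measurable_snd MeasurableSet.univ, preimage_univ, ← hu]
    exact le_self_add
  have hμu : μ univ ≤ ENNReal.ofReal m := hu ▸ le_add_self
  have hfin : IsFiniteMeasure (γ.map Prod.snd) := ⟨hγu.trans_lt ENNReal.ofReal_lt_top⟩
  set ν := (fMeas fun x => 1 - f x) - γ.map Prod.snd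
  have hνγ : ν + γ.map Prod.snd = fMeas fun x => 1 - f x := Measure.sub_add_cancel_of_le hγ
  have hvol : ν + γ.map Prod.snd + fMeas f = volume := by rw [hνγ, fMeas_one_sub_add hf]
  have hroom : ∀ i, μ (q ⁻¹' {i}) ≤ ν (q ⁻¹' {i}) := by
    intro i
    have h := (hV i).1
    rw [← hvol, Measure.add_apply, Measure.add_apply, ENNReal.ofReal_add (by positivity) hm.le,
      ENNReal.ofReal_add hm.le hm.le] at h
    have ha : (γ.map Prod.snd) (q ⁻¹' {i}) ≤ ENNReal.ofReal m :=
      (measure_mono (subset_univ _)).trans hγu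
    have hb : fMeas f (q ⁻¹' {i}) ≤ ENNReal.ofReal m :=
      (measure_mono (subset_univ _)).trans (by rw [fMeas_univ hf, hfm])
    refine ((measure_mono (subset_univ _)).trans hμu).trans ?_
    have h' := h.trans (add_le_add (add_le_add_right ha _) hb)
    rwa [ENNReal.add_le_add_iff_right ENNReal.ofReal_ne_top,
      ENNReal.add_le_add_iff_right ENNReal.ofReal_ne_top] at h'
  have hνfin : ∀ i, ν (q ⁻¹' {i}) ≠ ∞ := by
    intro i
    refine ne_top_of_le_ne_top (hV i).2 ?_
    rw [← hvol, Measure.add_apply, Measure.add_apply, add_assoc]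
    exact le_self_add
  obtain ⟨γ', h1, h2, h3⟩ := exists_plan_in_cells hq μ ν hroom hνfin
  have hmem : γ + γ' ∈ ExtPlans f := by
    refine ⟨?_, ?_⟩
    · rw [Measure.map_add _ _ measurable_fst, h1, hγμ]
    · rw [Measure.map_add _ _ measurable_snd, ← hνγ, add_comm]
      gcongr
  refine (iInf₂_le _ hmem).trans ?_
  rw [planCost, lintegral_add_measure, planCost]
  gcongr
  calc ∫⁻ p, ENNReal.ofReal (transCost k p.1 p.2) ∂γ'
      ≤ ∫⁻ _, ENNReal.ofReal (max K 1) ∂γ' := by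
        refine lintegral_mono_ae ?_
        filter_upwards [h3] with p hp
        refine ENNReal.ofReal_le_ofReal (le_trans (hK ⟨p.2 - p.1, ?_, rfl⟩) (le_max_left _ _))
        simpa using hD _ _ hp
    _ = ENNReal.ofReal (max K 1) * μ univ := by
        rw [lintegral_const, ← h1, Measure.map_apply measurable_fst MeasurableSet.univ,
          preimage_univ]

lemma Energy_ne_top {d : ℕ} (hd : 1 ≤ d) {k : Rd d → ℝ} (hk : Continuous k) {m : ℝ}
    (hm : 0 < m) : Energy (transCost k) m ≠ ∞ := by
  obtain ⟨K, _, hK⟩ := exists_Ups_le hd hk hm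
  refine ne_top_of_le_ne_top (b := ENNReal.ofReal K * ENNReal.ofReal m) (by finiteness) ?_
  refine iSup₂_le fun f hf => ?_
  have := hK f hf.1 hf.2 0 (fMeas f) (by simp)
    (by rw [Measure.map_zero]; exact Measure.zero_le _)
  rwa [fMeas_univ hf.1, hf.2, planCost, lintegral_zero_measure, zero_add] at this

lemma Energy_pos {d : ℕ} (hd : 1 ≤ d) {k : Rd d → ℝ} (h1 : H1 k) (h3 : H3 k) {m : ℝ}
    (hm : 0 < m) : 0 < Energy (transCost k) m := by
  have : Nonempty (Fin d) := ⟨⟨0, hd⟩⟩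
  have hd0 : (d : ℝ) ≠ 0 := by positivity
  set v := volume.real (Metric.ball (0 : Rd d) 1) with hv
  have hv0 : 0 < v :=
    ENNReal.toReal_pos (Metric.measure_ball_pos _ _ one_pos).ne' measure_ball_lt_top.ne
  set ρ := (m / v) ^ (1 / (d : ℝ)) with hρ
  have hρ0 : 0 < ρ := by positivity
  have hρd : ρ ^ d * v = m := by
    rw [hρ, ← Real.rpow_natCast, ← Real.rpow_mul (by positivity), one_div,
      inv_mul_cancel₀ hd0, Real.rpow_one, div_mul_cancel₀ _ hv0.ne']
  set f : Rd d → ℝ := (Metric.ball (0 : Rd d) ρ).indicator 1 with hf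
  have hfu : InUnit f := by
    refine ⟨(integrable_indicator_iff Metric.isOpen_ball.measurableSet).2 ?_, fun x => ?_⟩
    · exact integrableOn_const measure_ball_lt_top.ne
    · by_cases hx : x ∈ Metric.ball (0 : Rd d) ρ <;> simp [hf, hx]
  have hfm : ∫ x, f x = m := by
    rw [hf, integral_indicator_one Metric.isOpen_ball.measurableSet, ← hρd, hv,
      Measure.real, Measure.addHaar_ball _ _ hρ0.le, ENNReal.toReal_mul, Measure.real,
      ENNReal.toReal_ofReal (by positivity)]
    simp
  obtain ⟨κ, hκ0, hκ⟩ := exists_pos_le_of_le_norm h1 h3 (half_pos hρ0)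
  refine lt_of_lt_of_le ?_ (le_iSup₂ (f := fun f _ => Ups (transCost k) f) f ⟨hfu, hfm⟩)
  set B := Metric.ball (0 : Rd d) (ρ / 2) with hB
  have hBm : MeasurableSet B := Metric.isOpen_ball.measurableSet
  have hBpos : 0 < volume B := Metric.measure_ball_pos _ _ (half_pos hρ0)
  refine lt_of_lt_of_le (b := ENNReal.ofReal κ * volume B) ?_ (le_iInf₂ fun γ hγ => ?_)
  · exact ENNReal.mul_pos (by simpa using hκ0) hBpos.ne'
  have hsnd : ∀ᵐ p ∂γ, p.2 ∉ Metric.ball (0 : Rd d) ρ := by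
    have h0 : (γ.map Prod.snd) (Metric.ball (0 : Rd d) ρ) = 0 := by
      refine le_antisymm ((hγ.2 _).trans ?_) zero_le
      rw [fMeas, withDensity_apply _ Metric.isOpen_ball.measurableSet,
        setLIntegral_congr_fun (g := fun _ => 0) Metric.isOpen_ball.measurableSet
          (fun x hx => by simp [hf, indicator_of_mem hx])]
      simp
    rw [Measure.map_apply measurable_snd Metric.isOpen_ball.measurableSet] at h0
    exact measure_eq_zero_iff_ae_notMem.1 h0
  have hfst : volume B = γ (Prod.fst ⁻¹' B) := by
    rw [← Measure.map_apply measurable_fst hBm, hγ.1, fMeas, withDensity_apply _ hBm,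
      setLIntegral_congr_fun (g := fun _ => 1) hBm, setLIntegral_one]
    intro x hx
    simp [hf, indicator_of_mem (Metric.ball_subset_ball (half_le_self hρ0.le) hx)]
  rw [hfst, ← setLIntegral_const]
  refine (lintegral_mono_ae ?_).trans (setLIntegral_le_lintegral (Prod.fst ⁻¹' B) _)
  filter_upwards [ae_restrict_of_ae hsnd, ae_restrict_mem (measurable_fst hBm)] with p hp hp'
  refine ENNReal.ofReal_le_ofReal (hκ _ ?_)
  have a : ‖p.1‖ < ρ / 2 := by simpa [hB] using hp'
  have b : ρ ≤ ‖p.2‖ := by simpa using hp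
  linarith [norm_sub_norm_le p.2 p.1]

/-- Quantitative gain for the dilated cost, uniform over plans with given total mass. -/
lemma exists_gain_plans {d : ℕ} (hd : 1 ≤ d) {k : Rd d → ℝ} (hpos : ∀ x, 0 ≤ k x)
    (h1 : H1 k) (h3 : H3 k) {m l ε : ℝ} (hm : 0 < m) (hl : 1 < l) (hε : 0 < ε) :
    ∃ c > 0, ∀ f : Rd d → ℝ, InUnit f → ∫ x, f x = m → ∀ γ ∈ ExtPlans f,
      ENNReal.ofReal (1 + c) * Ups (transCost k) f ≤
        ∫⁻ p, ENNReal.ofReal (k (l • (p.2 - p.1))) ∂γ + ENNReal.ofReal (c * ε * m) := by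
  obtain ⟨K, hK0, hK⟩ := exists_Ups_le hd h1.1 hm
  obtain ⟨c, hc0, hc1, hc⟩ := exists_gain h1 h3 hl hε (2 * K)
  refine ⟨c, hc0, fun f hf hfm γ hγ => ?_⟩
  have hk := h1.1
  set G := {p : Rd d × Rd d | k (p.2 - p.1) ≤ 2 * K}
  have hGm : MeasurableSet G := (isClosed_le (by fun_prop) continuous_const).measurableSet
  have hUps := hK f hf hfm (γ.restrict G) ((γ.restrict Gᶜ).map Prod.fst)
    (by rw [← Measure.map_add _ _ measurable_fst, Measure.restrict_add_restrict_compl hGm, hγ.1])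
    ((Measure.map_mono Measure.restrict_le_self measurable_snd).trans hγ.2)
  rw [Measure.map_apply measurable_fst MeasurableSet.univ, preimage_univ,
    Measure.restrict_apply_univ, ← setLIntegral_const] at hUps
  have hpt : ∀ p : Rd d × Rd d, p ∈ G → ENNReal.ofReal (1 + c) *
      ENNReal.ofReal (transCost k p.1 p.2) ≤
      ENNReal.ofReal (k (l • (p.2 - p.1))) + ENNReal.ofReal (c * ε) := by
    intro p hp
    rw [← ENNReal.ofReal_mul (by positivity), ← ENNReal.ofReal_add (hpos _) (by positivity)]
    exact ENNReal.ofReal_le_ofReal (hc _ hp)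
  have hpt' : ∀ p : Rd d × Rd d, p ∈ Gᶜ → ENNReal.ofReal (1 + c) * ENNReal.ofReal K ≤
      ENNReal.ofReal (k (l • (p.2 - p.1))) + ENNReal.ofReal (c * ε) := by
    intro p hp
    rw [← ENNReal.ofReal_mul (by positivity), ← ENNReal.ofReal_add (hpos _) (by positivity)]
    refine ENNReal.ofReal_le_ofReal ?_
    have ha : 2 * K < k (p.2 - p.1) := not_le.1 hp
    have hb := h3.le_smul (p.2 - p.1) hl.le
    have : 0 < c * ε := by positivity
    nlinarith
  calc ENNReal.ofReal (1 + c) * Ups (transCost k) f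
      ≤ ENNReal.ofReal (1 + c) * (∫⁻ p in G, ENNReal.ofReal (transCost k p.1 p.2) ∂γ +
          ∫⁻ _ in Gᶜ, ENNReal.ofReal K ∂γ) := by gcongr; exact hUps
    _ = ∫⁻ p in G, ENNReal.ofReal (1 + c) * ENNReal.ofReal (transCost k p.1 p.2) ∂γ +
          ∫⁻ _ in Gᶜ, ENNReal.ofReal (1 + c) * ENNReal.ofReal K ∂γ := by
        rw [mul_add, lintegral_const_mul' _ _ ENNReal.ofReal_ne_top,
          lintegral_const_mul' _ _ ENNReal.ofReal_ne_top]
    _ ≤ ∫⁻ p in G, (ENNReal.ofReal (k (l • (p.2 - p.1))) + ENNReal.ofReal (c * ε)) ∂γ +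
          ∫⁻ p in Gᶜ, (ENNReal.ofReal (k (l • (p.2 - p.1))) + ENNReal.ofReal (c * ε)) ∂γ :=
        add_le_add (setLIntegral_mono' hGm hpt) (setLIntegral_mono' hGm.compl hpt')
    _ = ∫⁻ p, ENNReal.ofReal (k (l • (p.2 - p.1))) ∂γ + ENNReal.ofReal (c * ε * m) := by
        rw [lintegral_add_compl _ hGm, lintegral_add_right _ measurable_const, lintegral_const,
          ExtPlans.measure_univ hf hγ, hfm, ← ENNReal.ofReal_mul (by positivity)]

lemma map_smul_fMeas {d : ℕ} {a : ℝ} (ha : 0 < a) (f : Rd d → ℝ) :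
    (fMeas fun x => f (a⁻¹ • x)).map (a⁻¹ • ·) = ENNReal.ofReal (a ^ d) • fMeas f := by
  have he : MeasurableEmbedding (fun x : Rd d => a⁻¹ • x) :=
    (MeasurableEquiv.smul₀ a⁻¹ (inv_ne_zero ha.ne')).measurableEmbedding
  ext s hs
  rw [he.map_apply, fMeas, fMeas, withDensity_apply _ (he.measurable hs), Measure.smul_apply,
    withDensity_apply _ hs]
  rw [← he.lintegral_map (f := fun x => ENNReal.ofReal (f x)), ← he.restrict_map,
    Measure.map_addHaar_smul _ (inv_ne_zero ha.ne'), Measure.restrict_smul,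
    lintegral_smul_measure]
  simp [abs_of_pos ha]

/-- Rescaling of admissible plans. -/
lemma exists_plan_rescale {d : ℕ} {k : Rd d → ℝ} (hk : Continuous k) {a : ℝ} (ha : 0 < a)
    (f : Rd d → ℝ) {γ : Measure (Rd d × Rd d)} (hγ : γ ∈ ExtPlans fun x => f (a⁻¹ • x)) :
    ∃ γ' ∈ ExtPlans f, planCost (transCost k) γ =
      ENNReal.ofReal (a ^ d) * ∫⁻ p, ENNReal.ofReal (k (a • (p.2 - p.1))) ∂γ' := by
  have hC0 : ENNReal.ofReal (a ^ d) ≠ 0 := by simpa using pow_pos ha d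
  have hC : (ENNReal.ofReal (a ^ d))⁻¹ * ENNReal.ofReal (a ^ d) = 1 :=
    ENNReal.inv_mul_cancel hC0 ENNReal.ofReal_ne_top
  set Φ : Rd d × Rd d → Rd d × Rd d := fun p => (a⁻¹ • p.1, a⁻¹ • p.2) with hΦ
  have hΦm : Measurable Φ := by fun_prop
  have hs : Measurable (fun x : Rd d => a⁻¹ • x) := by fun_prop
  refine ⟨(ENNReal.ofReal (a ^ d))⁻¹ • γ.map Φ, ⟨?_, ?_⟩, ?_⟩
  · have : (γ.map Φ).map Prod.fst = ENNReal.ofReal (a ^ d) • fMeas f := by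
      rw [← map_smul_fMeas ha, ← hγ.1, Measure.map_map hs measurable_fst,
        Measure.map_map measurable_fst hΦm]
      rfl
    rw [Measure.map_smul, this, smul_smul, hC, one_smul]
  · have : (γ.map Φ).map Prod.snd ≤ ENNReal.ofReal (a ^ d) • fMeas fun x => 1 - f x := by
      rw [← map_smul_fMeas ha, Measure.map_map measurable_snd hΦm]
      refine le_trans (le_of_eq ?_) (Measure.map_mono hγ.2 hs)
      rw [Measure.map_map hs measurable_snd]
      rfl
    rw [Measure.map_smul]
    refine Measure.le_iff.2 fun s _ => ?_
    have h := this s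
    rw [Measure.smul_apply, smul_eq_mul] at h ⊢
    calc (ENNReal.ofReal (a ^ d))⁻¹ * _
        ≤ (ENNReal.ofReal (a ^ d))⁻¹ * (ENNReal.ofReal (a ^ d) * _) := by gcongr
      _ = _ := by rw [← mul_assoc, hC, one_mul]
  · rw [lintegral_smul_measure, smul_eq_mul, ← mul_assoc, mul_comm (ENNReal.ofReal _), hC,
      one_mul, lintegral_map (by fun_prop) hΦm, planCost]
    refine lintegral_congr fun p => ?_
    simp [hΦ, transCost, smul_sub, smul_smul, ha.ne']

lemma InUnit.comp_smul {d : ℕ} {f : Rd d → ℝ} (hf : InUnit f) {a : ℝ} (ha : 0 < a) :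
    InUnit fun x => f (a⁻¹ • x) :=
  ⟨hf.1.comp_smul (inv_ne_zero ha.ne'), fun _ => hf.2 _⟩

lemma Energy_div_lt {d : ℕ} (hd : 1 ≤ d) {k : Rd d → ℝ} (hpos : ∀ x, 0 ≤ k x)
    (h1 : H1 k) (h3 : H3 k) {m₁ m₂ : ℝ} (hm₁ : 0 < m₁) (hm : m₁ < m₂) :
    Energy (transCost k) m₁ / ENNReal.ofReal m₁ <
      Energy (transCost k) m₂ / ENNReal.ofReal m₂ := by
  have hm₂ : 0 < m₂ := hm₁.trans hm
  have hd0 : (d : ℝ) ≠ 0 := by positivity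
  obtain ⟨l, hl, hld⟩ : ∃ l : ℝ, 1 < l ∧ l ^ d = m₂ / m₁ := by
    refine ⟨(m₂ / m₁) ^ (1 / (d : ℝ)), Real.one_lt_rpow ((one_lt_div hm₁).2 hm) (by positivity),
      ?_⟩
    rw [← Real.rpow_natCast, ← Real.rpow_mul (by positivity), one_div, inv_mul_cancel₀ hd0,
      Real.rpow_one]
  have hl0 : 0 < l := one_pos.trans hl
  obtain ⟨E₁, hE₁0, hE₁⟩ : ∃ E > 0, Energy (transCost k) m₁ = ENNReal.ofReal E :=
    ⟨_, ENNReal.toReal_pos (Energy_pos hd h1 h3 hm₁).ne' (Energy_ne_top hd h1.1 hm₁),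
      (ENNReal.ofReal_toReal (Energy_ne_top hd h1.1 hm₁)).symm⟩
  obtain ⟨E₂, hE₂0, hE₂⟩ : ∃ E > 0, Energy (transCost k) m₂ = ENNReal.ofReal E :=
    ⟨_, ENNReal.toReal_pos (Energy_pos hd h1 h3 hm₂).ne' (Energy_ne_top hd h1.1 hm₂),
      (ENNReal.ofReal_toReal (Energy_ne_top hd h1.1 hm₂)).symm⟩
  obtain ⟨c, hc0, hc⟩ := exists_gain_plans hd hpos h1 h3 hm₁ hl
    (ε := E₁ / (2 * m₁)) (by positivity)
  have hbound : ∀ f : Rd d → ℝ, InUnit f → ∫ x, f x = m₁ →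
      ENNReal.ofReal (l ^ d) * (ENNReal.ofReal (1 + c) * Ups (transCost k) f) ≤
        ENNReal.ofReal E₂ +
          ENNReal.ofReal (l ^ d) * ENNReal.ofReal (c * (E₁ / (2 * m₁)) * m₁) := by
    intro f hf hfm
    have hmass : ∫ x : Rd d, f (l⁻¹ • x) = m₂ := by
      rw [Measure.integral_comp_inv_smul_of_nonneg _ _ hl0.le, hfm, finrank_euclideanSpace,
        Fintype.card_fin, hld, smul_eq_mul, div_mul_cancel₀ _ hm₁.ne']
    have hle : Ups (transCost k) (fun x => f (l⁻¹ • x)) ≤ ENNReal.ofReal E₂ :=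
      hE₂ ▸ le_iSup₂ (f := fun f _ => Ups (transCost k) f) _ ⟨hf.comp_smul hl0, hmass⟩
    refine le_trans ?_ (add_le_add_left hle _)
    rw [← tsub_le_iff_right]
    refine le_iInf₂ fun γ hγ => ?_
    obtain ⟨γ', hγ', hcost⟩ := exists_plan_rescale h1.1 hl0 f hγ
    rw [hcost, tsub_le_iff_right, ← mul_add]
    gcongr
    exact hc f hf hfm γ' hγ'
  have hsup : ENNReal.ofReal (l ^ d) * (ENNReal.ofReal (1 + c) * ENNReal.ofReal E₁) ≤
        ENNReal.ofReal E₂ +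
          ENNReal.ofReal (l ^ d) * ENNReal.ofReal (c * (E₁ / (2 * m₁)) * m₁) := by
    rw [← hE₁, Energy]
    simp_rw [ENNReal.mul_iSup]
    exact iSup₂_le fun f hf => hbound f hf.1 hf.2
  rw [← ENNReal.ofReal_mul (by positivity), ← ENNReal.ofReal_mul (by positivity),
    ← ENNReal.ofReal_mul (by positivity), ← ENNReal.ofReal_add (by positivity) (by positivity),
    ENNReal.ofReal_le_ofReal_iff (by positivity), hld] at hsup
  rw [hE₁, hE₂, ← ENNReal.ofReal_div_of_pos hm₁, ← ENNReal.ofReal_div_of_pos hm₂,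
    ENNReal.ofReal_lt_ofReal_iff (by positivity), div_lt_div_iff₀ hm₁ hm₂]
  have hgain : 0 < m₂ * (c * E₁) := by positivity
  field_simp at hsup
  nlinarith

/-- under (H1),(H3), `m ↦ ℰ(m)/m` is strictly increasing on `(0,∞)`; as a
consequence `ℰ` is strictly superadditive. -/
theorem stmt_17 {d : ℕ} (hd : 1 ≤ d) (k : Rd d → ℝ) (hpos : ∀ x, 0 ≤ k x)
    (h1 : H1 k) (h3 : H3 k) :
    StrictMonoOn (fun m : ℝ => Energy (transCost k) m / ENNReal.ofReal m) (Set.Ioi 0) ∧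
    ∀ m' m : ℝ, 0 < m' → m' < m →
      Energy (transCost k) m' + Energy (transCost k) (m - m') < Energy (transCost k) m := by
  have hlt : ∀ m₁ m₂ : ℝ, 0 < m₁ → m₁ < m₂ → _ := fun _ _ => Energy_div_lt hd hpos h1 h3
  refine ⟨fun m₁ hm₁ m₂ _ h => hlt m₁ m₂ hm₁ h, fun m' m hm' hm => ?_⟩
  have hm0 : 0 < m := hm'.trans hm
  have hs : 0 < m - m' := sub_pos.2 hm
  have key : ∀ s, 0 < s → s < m → Energy (transCost k) s <
      Energy (transCost k) m / ENNReal.ofReal m * ENNReal.ofReal s := fun s hs hsm =>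
    (ENNReal.div_lt_iff (.inl (by simpa using hs)) (.inl ENNReal.ofReal_ne_top)).1 (hlt s m hs hsm)
  calc _ < _ := ENNReal.add_lt_add (key m' hm' hm) (key (m - m') hs (by linarith))
    _ = Energy (transCost k) m := by
      rw [← mul_add, ← ENNReal.ofReal_add hm'.le hs.le, add_sub_cancel,
        ENNReal.div_mul_cancel (by simpa using hm0) ENNReal.ofReal_ne_top]
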